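/- Let f be a parabolic Monge form with (a_{3,0}, a_{2,1}) ≠ (0,0) (the parabolic set is nonsingular at the origin). Let c = (c₁,c₂) : (−ε,ε) → ℝ² be C^∞ with c(0) = (0,0), c'(0) ≠ (0,0) and P(c(t)) = 0 for all |t| < ε, set L(t) = (c₁(t), c₂(t), f(c(t))), and assume L'(0) × L''(0) ≠ 0 (the curvature of L at 0 is nonzero). Then f has an A₂ singularity at (0,0) if and only if the unit binormal b(0) of L at 0 is not equal to ±(0,0,1). -/

import Mathlib

open Real Set

noncomputable section

/-- Partial derivative in the first variable. -/
def pdu {F : Type*} [NormedAddCommGroup F] [NormedSpace ℝ F] (f : ℝ → ℝ → F) : ℝ → ℝ → F :=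
  fun u w => deriv (fun t => f t w) u

/-- Partial derivative in the second variable. -/
def pdw {F : Type*} [NormedAddCommGroup F] [NormedSpace ℝ F] (f : ℝ → ℝ → F) : ℝ → ℝ → F :=
  fun u w => deriv (fun t => f u t) w

/-- Iterated partial derivative `∂_u^i ∂_w^j f`. -/
def pd {F : Type*} [NormedAddCommGroup F] [NormedSpace ℝ F] (i j : ℕ) (f : ℝ → ℝ → F) :
    ℝ → ℝ → F :=
  pdu^[i] (pdw^[j] f)

/-- The Euclidean inner product on `ℝ³ = ℝ × ℝ × ℝ`. -/
def dot3 (x y : ℝ × ℝ × ℝ) : ℝ := x.1 * y.1 + x.2.1 * y.2.1 + x.2.2 * y.2.2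

/-- The cross product on `ℝ³ = ℝ × ℝ × ℝ`. -/
def cross3 (x y : ℝ × ℝ × ℝ) : ℝ × ℝ × ℝ :=
  (x.2.1 * y.2.2 - x.2.2 * y.2.1, x.2.2 * y.1 - x.1 * y.2.2, x.1 * y.2.1 - x.2.1 * y.1)

/-- The Euclidean norm on `ℝ³ = ℝ × ℝ × ℝ`. -/
def norm3 (x : ℝ × ℝ × ℝ) : ℝ := Real.sqrt (dot3 x x)

/-- The surface parameterization `g(u,w) = (u, p(u,w), q(u,w))`. -/
def gmap (p q : ℝ → ℝ → ℝ) : ℝ → ℝ → ℝ × ℝ × ℝ := fun u w => (u, p u w, q u w)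

/-- The height function on the surface parameterized by `g = (u, p, q)` along `v`. -/
def hgt (p q : ℝ → ℝ → ℝ) (v : ℝ × ℝ × ℝ) : ℝ → ℝ → ℝ :=
  fun u w => dot3 (gmap p q u w) v

/-- `g = (u, p(u,w), q(u,w))` is in normal form of order `N`. -/
def NormalFormN (N : ℕ) (p q : ℝ → ℝ → ℝ) (b : ℕ → ℝ) (a : ℕ → ℕ → ℝ) : Prop :=
  ContDiff ℝ (⊤ : ℕ∞) (fun x : ℝ × ℝ => p x.1 x.2) ∧
  ContDiff ℝ (⊤ : ℕ∞) (fun x : ℝ × ℝ => q x.1 x.2) ∧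
  p 0 0 = 0 ∧ q 0 0 = 0 ∧
  pd 1 0 p 0 0 = 0 ∧ pd 0 1 p 0 0 = 0 ∧ pd 1 0 q 0 0 = 0 ∧ pd 0 1 q 0 0 = 0 ∧
  pd 0 2 p 0 0 = 1 ∧
  (∀ i, 2 ≤ i → i ≤ N → pd i 0 p 0 0 = b i) ∧
  (∀ i j, 2 ≤ i + j → i + j ≤ N → 1 ≤ j → ¬(i = 0 ∧ j = 2) → pd i j p 0 0 = 0) ∧
  (∀ i j, 2 ≤ i + j → i + j ≤ N → pd i j q 0 0 = a i j) ∧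
  a 1 1 = 0 ∧ a 0 2 = 0

/-- `h` has an `A_k` singularity at the origin: up to a `C^∞` change of coordinates fixing
the origin, `h` equals `h(0,0) ± x² ± y^(k+1)`. -/
def HasAkSingAt (h : ℝ → ℝ → ℝ) (k : ℕ) : Prop :=
  ∃ (U V : Set (ℝ × ℝ)) (φ ψ : ℝ × ℝ → ℝ × ℝ) (ε₁ ε₂ : ℝ),
    IsOpen U ∧ IsOpen V ∧ ((0, 0) : ℝ × ℝ) ∈ U ∧ ((0, 0) : ℝ × ℝ) ∈ V ∧
    ContDiffOn ℝ (⊤ : ℕ∞) φ U ∧ ContDiffOn ℝ (⊤ : ℕ∞) ψ V ∧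
    Set.MapsTo φ U V ∧ Set.MapsTo ψ V U ∧
    (∀ x ∈ U, ψ (φ x) = x) ∧ (∀ y ∈ V, φ (ψ y) = y) ∧
    φ (0, 0) = (0, 0) ∧ (ε₁ = 1 ∨ ε₁ = -1) ∧ (ε₂ = 1 ∨ ε₂ = -1) ∧
    ∀ x ∈ U, h (φ x).1 (φ x).2 = h 0 0 + ε₁ * x.1 ^ 2 + ε₂ * x.2 ^ (k + 1)

/-- The parabolic-set function `Σ = ⟨g_uu, g_u × g_w⟩⟨g_ww, g_u × g_w⟩ − ⟨g_uw, g_u × g_w⟩²`. -/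
def SigmaFun (p q : ℝ → ℝ → ℝ) : ℝ → ℝ → ℝ := fun u w =>
  dot3 (pd 2 0 (gmap p q) u w) (cross3 (pd 1 0 (gmap p q) u w) (pd 0 1 (gmap p q) u w)) *
      dot3 (pd 0 2 (gmap p q) u w) (cross3 (pd 1 0 (gmap p q) u w) (pd 0 1 (gmap p q) u w)) -
    dot3 (pd 1 1 (gmap p q) u w) (cross3 (pd 1 0 (gmap p q) u w) (pd 0 1 (gmap p q) u w)) ^ 2

/-- The torsion of a space curve `L`. -/
def tor (L : ℝ → ℝ × ℝ × ℝ) : ℝ → ℝ := fun t =>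
  dot3 (cross3 (deriv L t) (deriv (deriv L) t)) (deriv (deriv (deriv L)) t) /
    norm3 (cross3 (deriv L t) (deriv (deriv L) t)) ^ 2

/-- The unit binormal vector of a space curve `L` at `t = 0`. -/
def binormal0 (L : ℝ → ℝ × ℝ × ℝ) : ℝ × ℝ × ℝ :=
  (norm3 (cross3 (deriv L 0) (deriv (deriv L) 0)))⁻¹ • cross3 (deriv L 0) (deriv (deriv L) 0)

/-- `f` is a parabolic Monge form with `∂_w² f(0,0) = k₂ ≠ 0`. -/
def MongeForm (f : ℝ → ℝ → ℝ) (k₂ : ℝ) : Prop :=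
  ContDiff ℝ (⊤ : ℕ∞) (fun x : ℝ × ℝ => f x.1 x.2) ∧ f 0 0 = 0 ∧
  pd 1 0 f 0 0 = 0 ∧ pd 0 1 f 0 0 = 0 ∧
  pd 2 0 f 0 0 = 0 ∧ pd 1 1 f 0 0 = 0 ∧ pd 0 2 f 0 0 = k₂ ∧ k₂ ≠ 0

/-- The parabolic-set function `P = f_uu f_ww − f_uw²` of a Monge form. -/
def Pfun (f : ℝ → ℝ → ℝ) : ℝ → ℝ → ℝ := fun u w =>
  pd 2 0 f u w * pd 0 2 f u w - pd 1 1 f u w ^ 2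

open Filter Topology
open scoped ContDiff

/-- An integral over `[0, 1]` depending on a parameter is as smooth as its integrand. -/
theorem contDiff_parametric_integral_nat {E F : Type} [NormedAddCommGroup E] [NormedSpace ℝ E]
    [ProperSpace E] [NormedAddCommGroup F] [NormedSpace ℝ F] (n : ℕ) (G : E × ℝ → F)
    (hG : ContDiff ℝ n G) : ContDiff ℝ n (fun x => ∫ t in (0 : ℝ)..1, G (x, t)) := by
  induction n generalizing F with
  | zero =>
    refine contDiff_zero.2 ?_
    exact intervalIntegral.continuous_parametric_intervalIntegral_of_continuous'
      (f := fun x t => G (x, t)) hG.continuous 0 1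
  | succ n ih =>
    have hfd : ContDiff ℝ n (fderiv ℝ G) := hG.fderiv_right (by norm_cast)
    have hG' : ContDiff ℝ n
        (fun z : E × ℝ => (fderiv ℝ G z).comp (ContinuousLinearMap.inl ℝ E ℝ)) :=
      hfd.clm_comp contDiff_const
    have hderiv : ∀ x t, HasFDerivAt (fun x => G (x, t))
        ((fderiv ℝ G (x, t)).comp (ContinuousLinearMap.inl ℝ E ℝ)) x := fun x t =>
      ((hG.differentiable (by simp)).differentiableAt.hasFDerivAt (x := (x, t))).comp x
        (hasFDerivAt_prodMk_left x t)
    have key := contDiff_succ_iff_hasFDerivAt (𝕜 := ℝ) (n := n)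
      (f := fun x => ∫ t in (0 : ℝ)..1, G (x, t))
    norm_cast at key
    push_cast at key ⊢
    refine key.2 ⟨_, ih _ hG', fun x₀ => ?_⟩
    obtain ⟨B, hB⟩ := ((isCompact_closedBall x₀ 1).prod
      (isCompact_Icc (a := (0 : ℝ)) (b := 1))).exists_bound_of_continuousOn hG'.continuous.continuousOn
    refine intervalIntegral.hasFDerivAt_integral_of_dominated_of_fderiv_le
      (F := fun x t => G (x, t))
      (F' := fun x t => (fderiv ℝ G (x, t)).comp (ContinuousLinearMap.inl ℝ E ℝ))
      (s := Metric.closedBall x₀ 1) (bound := fun _ => B)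
      (Metric.closedBall_mem_nhds x₀ one_pos) (Eventually.of_forall fun x => ?_) ?_ ?_ ?_ ?_ ?_
    · exact (hG.continuous.comp (by fun_prop : Continuous fun t : ℝ => (x, t))).aestronglyMeasurable
    · exact (hG.continuous.comp
        (by fun_prop : Continuous fun t : ℝ => (x₀, t))).intervalIntegrable _ _
    · exact (hG'.continuous.comp
        (by fun_prop : Continuous fun t : ℝ => (x₀, t))).aestronglyMeasurable
    · refine Eventually.of_forall fun t ht x hx => hB (x, t) ⟨hx, ?_⟩
      rw [uIoc_of_le zero_le_one] at ht
      exact ⟨ht.1.le, ht.2⟩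
    · simp
    · exact Eventually.of_forall fun t _ x _ => hderiv x t

theorem contDiff_parametric_integral {E F : Type} [NormedAddCommGroup E] [NormedSpace ℝ E]
    [ProperSpace E] [NormedAddCommGroup F] [NormedSpace ℝ F] (G : E × ℝ → F)
    (hG : ContDiff ℝ ∞ G) : ContDiff ℝ ∞ (fun x => ∫ t in (0 : ℝ)..1, G (x, t)) :=
  contDiff_infty.2 fun n => contDiff_parametric_integral_nat n G (contDiff_infty.1 hG n)

/-- Hadamard's lemma with a parameter. -/
theorem exists_hadamard_quotient (F : ℝ × ℝ → ℝ) (hF : ContDiff ℝ ∞ F) :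
    ∃ G : ℝ × ℝ → ℝ, ContDiff ℝ ∞ G ∧ ∀ u w, F (u, w) = F (u, 0) + w * G (u, w) := by
  have hfd : ContDiff ℝ ∞ (fderiv ℝ F) := hF.fderiv_right (by simp)
  refine ⟨fun x => ∫ t in (0 : ℝ)..1, fderiv ℝ F (x.1, t * x.2) (0, 1), ?_, fun u w => ?_⟩
  · refine contDiff_parametric_integral
      (fun z : (ℝ × ℝ) × ℝ => fderiv ℝ F (z.1.1, z.2 * z.1.2) (0, 1)) ?_
    exact (hfd.comp (by fun_prop)).clm_apply contDiff_const
  · have hd : ∀ t ∈ uIcc (0 : ℝ) 1, HasDerivAt (fun t : ℝ => F (u, t * w))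
        (w * fderiv ℝ F (u, t * w) (0, 1)) t := fun t _ => by
      have h1 : HasDerivAt (fun t : ℝ => (u, t * w)) (0, w) t := by
        simpa using (hasDerivAt_const t u).prodMk ((hasDerivAt_id t).mul_const w)
      have h2 := ((hF.differentiable (by simp)).differentiableAt.hasFDerivAt
        (x := (u, t * w))).comp_hasDerivAt t h1
      have h3 : ((0 : ℝ), w) = w • ((0 : ℝ), (1 : ℝ)) := by simp
      rw [h3, map_smul, smul_eq_mul] at h2
      exact h2
    have hint : IntervalIntegrable (fun t : ℝ => w * fderiv ℝ F (u, t * w) (0, 1))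
        MeasureTheory.volume 0 1 := by
      refine Continuous.intervalIntegrable ?_ _ _
      have := hfd.continuous
      fun_prop
    have h := intervalIntegral.integral_eq_sub_of_hasDerivAt hd hint
    rw [intervalIntegral.integral_const_mul] at h
    simp only [one_mul, zero_mul] at h
    rw [h]
    ring

/-- Hadamard's lemma on the line. -/
theorem exists_hadamard_quotient_line (h : ℝ → ℝ) (hh : ContDiff ℝ ∞ h) :
    ∃ g : ℝ → ℝ, ContDiff ℝ ∞ g ∧ ∀ t, h t = h 0 + t * g t := by
  obtain ⟨G, hG, hFG⟩ := exists_hadamard_quotient (fun z => h z.2) (hh.comp contDiff_snd)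
  exact ⟨fun t => G (0, t), hG.comp (by fun_prop), fun t => hFG 0 t⟩

/-- Differentiating a multiple of `t ^ (n + 1)` yields a multiple of `t ^ n`. -/
theorem exists_deriv_pow_succ_mul (n : ℕ) (g : ℝ → ℝ) (hg : ContDiff ℝ ∞ g) :
    ∃ k : ℝ → ℝ, ContDiff ℝ ∞ k ∧ k 0 = (n + 1) * g 0 ∧
      deriv (fun t => t ^ (n + 1) * g t) = fun t => t ^ n * k t := by
  refine ⟨fun t => (n + 1) * g t + t * deriv g t, ?_, by simp, ?_⟩
  · have : ContDiff ℝ ∞ (deriv g) := (contDiff_infty_iff_deriv.1 hg).2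
    fun_prop
  · funext t
    have h := ((hasDerivAt_id t).pow (n + 1)).mul
      (hg.differentiable (by simp) t).hasDerivAt
    refine (h.deriv).trans ?_
    simp
    ring

/-- A smooth function vanishing to first order is a multiple of `t ^ 2`. -/
theorem exists_sq_mul (h : ℝ → ℝ) (hh : ContDiff ℝ ∞ h) (h0 : h 0 = 0) (h1 : deriv h 0 = 0) :
    ∃ g : ℝ → ℝ, ContDiff ℝ ∞ g ∧ (∀ t, h t = t ^ 2 * g t) ∧ deriv (deriv h) 0 = 2 * g 0 := by
  obtain ⟨g₁, hg₁, e₁⟩ := exists_hadamard_quotient_line h hh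
  obtain ⟨k, -, hk0, hk⟩ := exists_deriv_pow_succ_mul 0 g₁ hg₁
  have e₁' : h = fun t => t ^ (0 + 1) * g₁ t := by funext t; rw [e₁ t, h0]; ring
  have hz : g₁ 0 = 0 := by
    rw [e₁', hk] at h1
    simpa [hk0] using h1
  obtain ⟨g₂, hg₂, e₂⟩ := exists_hadamard_quotient_line g₁ hg₁
  have e : ∀ t, h t = t ^ 2 * g₂ t := fun t => by rw [e₁ t, e₂ t, h0, hz]; ring
  refine ⟨g₂, hg₂, e, ?_⟩
  obtain ⟨k₁, hk₁, hk₁0, ek₁⟩ := exists_deriv_pow_succ_mul 1 g₂ hg₂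
  obtain ⟨k₂, -, hk₂0, ek₂⟩ := exists_deriv_pow_succ_mul 0 k₁ hk₁
  have e' : h = fun t => t ^ (1 + 1) * g₂ t := funext e
  have ek₁' : deriv h = fun t => t ^ (0 + 1) * k₁ t := by rw [e', ek₁]
  rw [ek₁', ek₂]
  simp [hk₂0, hk₁0]
  norm_num

/-- A smooth function vanishing to second order is a multiple of `t ^ 3`. -/
theorem exists_cube_mul (h : ℝ → ℝ) (hh : ContDiff ℝ ∞ h) (h0 : h 0 = 0) (h1 : deriv h 0 = 0)
    (h2 : deriv (deriv h) 0 = 0) :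
    ∃ g : ℝ → ℝ, ContDiff ℝ ∞ g ∧ (∀ t, h t = t ^ 3 * g t) ∧
      deriv (deriv (deriv h)) 0 = 6 * g 0 := by
  obtain ⟨g₁, hg₁, e₁, hd⟩ := exists_sq_mul h hh h0 h1
  have hz : g₁ 0 = 0 := by linarith
  obtain ⟨g, hg, e₂⟩ := exists_hadamard_quotient_line g₁ hg₁
  have e : ∀ t, h t = t ^ 3 * g t := fun t => by rw [e₁ t, e₂ t, hz]; ring
  refine ⟨g, hg, e, ?_⟩
  obtain ⟨k₁, hk₁, hk₁0, ek₁⟩ := exists_deriv_pow_succ_mul 2 g hg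
  obtain ⟨k₂, hk₂, hk₂0, ek₂⟩ := exists_deriv_pow_succ_mul 1 k₁ hk₁
  obtain ⟨k₃, -, hk₃0, ek₃⟩ := exists_deriv_pow_succ_mul 0 k₂ hk₂
  have e' : h = fun t => t ^ (2 + 1) * g t := funext e
  have ek₁' : deriv h = fun t => t ^ (1 + 1) * k₁ t := by rw [e', ek₁]
  have ek₂' : deriv (deriv h) = fun t => t ^ (0 + 1) * k₂ t := by rw [ek₁', ek₂]
  rw [ek₂', ek₃]
  simp [hk₃0, hk₂0, hk₁0]
  ring

/-- A parabolic Monge form is `u³ A(u) + w u² D(u) + w² C(u, w)`. -/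
theorem MongeForm.exists_decomposition {f : ℝ → ℝ → ℝ} {k₂ : ℝ} (hM : MongeForm f k₂) :
    ∃ (A D : ℝ → ℝ) (C : ℝ × ℝ → ℝ), ContDiff ℝ ∞ A ∧ ContDiff ℝ ∞ D ∧ ContDiff ℝ ∞ C ∧
      (∀ u w, f u w = u ^ 3 * A u + w * (u ^ 2 * D u) + w ^ 2 * C (u, w)) ∧
      pd 3 0 f 0 0 = 6 * A 0 ∧ k₂ = 2 * C (0, 0) := by
  obtain ⟨hf, f0, fu, fw, fuu, fuw, fww, -⟩ := hM
  obtain ⟨G, hG, eG⟩ := exists_hadamard_quotient _ hf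
  obtain ⟨C, hC, eC⟩ := exists_hadamard_quotient G hG
  have hB0 : ∀ u, pd 0 1 f u 0 = G (u, 0) := fun u => by
    have hg : ContDiff ℝ ∞ fun t => G (u, t) := hG.comp (by fun_prop)
    have h : HasDerivAt (fun t => f u t) (G (u, 0)) 0 := by
      have := ((hasDerivAt_id (0 : ℝ)).mul
        (hg.differentiable (by simp) 0).hasDerivAt).const_add (f u 0)
      simp only [id, one_mul, zero_mul, add_zero] at this
      refine this.congr_of_eventuallyEq (Eventually.of_forall fun t => ?_)
      exact eG u t
    exact h.deriv
  have hGu : ContDiff ℝ ∞ fun t => G (t, 0) := hG.comp (by fun_prop)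
  have hfu : ContDiff ℝ ∞ fun t => f t 0 :=
    hf.comp (by fun_prop : ContDiff ℝ ∞ fun t : ℝ => (t, (0 : ℝ)))
  have hfw : ContDiff ℝ ∞ fun t => f 0 t :=
    hf.comp (by fun_prop : ContDiff ℝ ∞ fun t : ℝ => ((0 : ℝ), t))
  obtain ⟨A, hA, eA, hA0⟩ := exists_cube_mul (fun t => f t 0) hfu f0 fu fuu
  obtain ⟨D, hD, eD, -⟩ := exists_sq_mul (fun t => G (t, 0)) hGu (by rw [← hB0, fw]) (by
    have h : deriv (fun t => pd 0 1 f t 0) 0 = 0 := fuw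
    simpa only [hB0] using h)
  obtain ⟨g, hg, eg, hg0⟩ := exists_sq_mul (fun t => f 0 t) hfw f0 fw
  have ef : ∀ u w, f u w = u ^ 3 * A u + w * (u ^ 2 * D u) + w ^ 2 * C (u, w) := fun u w => by
    have h1 := eG u w
    have h2 := eC u w
    have h3 := eA u
    have h4 := eD u
    simp only at h1 h2 h3 h4
    rw [h1, h2, h3, h4]
    ring
  refine ⟨A, D, C, hA, hD, hC, ef, hA0, ?_⟩
  have hgC : g 0 = C (0, 0) := by
    have hCw : Continuous fun t : ℝ => C (0, t) := hC.continuous.comp (by fun_prop)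
    have hlim : EqOn (fun t : ℝ => g t) (fun t : ℝ => C (0, t)) {0}ᶜ := fun t ht => by
      have h1 := eg t
      have h2 := ef 0 t
      have h3 : t ^ 2 ≠ 0 := pow_ne_zero 2 ht
      apply mul_left_cancel₀ h3
      simp only at h1 ⊢
      rw [← h1, h2]
      ring
    exact congrFun (Continuous.ext_on (dense_compl_singleton (0 : ℝ)) hg.continuous hCw hlim) 0
  rw [← fww, ← hgC, ← hg0]
  rfl

/-- The inverse function theorem with a `C^∞` inverse on a whole neighbourhood. -/
theorem exists_openPartialHomeomorph_contDiffOn_symm {E : Type*} [NormedAddCommGroup E]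
    [NormedSpace ℝ E] [CompleteSpace E] {Ψ : E → E} {W : Set E} {x₀ : E} (hW : IsOpen W)
    (hx₀ : x₀ ∈ W) (hΨ : ContDiffOn ℝ ∞ Ψ W) (e : E ≃L[ℝ] E)
    (he : HasFDerivAt Ψ (e : E →L[ℝ] E) x₀) :
    ∃ Φ : OpenPartialHomeomorph E E, x₀ ∈ Φ.source ∧ Φ.source ⊆ W ∧ (Φ : E → E) = Ψ ∧
      ContDiffOn ℝ ∞ Φ.symm Φ.target := by
  have hat : ContDiffAt ℝ ∞ Ψ x₀ := hΨ.contDiffAt (hW.mem_nhds hx₀)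
  let S : Set E := W ∩ fderiv ℝ Ψ ⁻¹' range ((↑) : (E ≃L[ℝ] E) → E →L[ℝ] E)
  have hS : IsOpen S :=
    (hΨ.continuousOn_fderiv_of_isOpen hW (by simp)).isOpen_inter_preimage hW
      ContinuousLinearEquiv.isOpen
  have hxS : x₀ ∈ S := ⟨hx₀, e, he.fderiv.symm⟩
  let Φ := (hat.toOpenPartialHomeomorph Ψ he (by simp)).restrOpen S hS
  have hsub : Φ.source ⊆ S := fun x hx => hx.2
  refine ⟨Φ, ⟨hat.mem_toOpenPartialHomeomorph_source he (by simp), hxS⟩,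
    fun x hx => (hsub hx).1, rfl, fun y hy => ?_⟩
  have hy' := hsub (Φ.map_target hy)
  obtain ⟨e', he'⟩ := hy'.2
  have hc : ContDiffAt ℝ ∞ Ψ (Φ.symm y) := hΨ.contDiffAt (hW.mem_nhds hy'.1)
  refine (Φ.contDiffAt_symm (f₀' := e') hy ?_ hc).contDiffWithinAt
  rw [he']
  exact (hc.differentiableAt (by simp)).hasFDerivAt

theorem exists_sign_mul_pos {a : ℝ} (ha : a ≠ 0) : ∃ σ : ℝ, (σ = 1 ∨ σ = -1) ∧ 0 < σ * a := by
  rcases ha.lt_or_gt with h | h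
  · exact ⟨-1, Or.inr rfl, by linarith⟩
  · exact ⟨1, Or.inl rfl, by linarith⟩

/-- The linear isomorphism `(u, w) ↦ (s w, r u)`. -/
def swapScale (s r : ℝ) (hs : s ≠ 0) (hr : r ≠ 0) : (ℝ × ℝ) ≃L[ℝ] (ℝ × ℝ) :=
  ContinuousLinearEquiv.equivOfInverse
    ((s • ContinuousLinearMap.snd ℝ ℝ ℝ).prod (r • ContinuousLinearMap.fst ℝ ℝ ℝ))
    ((r⁻¹ • ContinuousLinearMap.snd ℝ ℝ ℝ).prod (s⁻¹ • ContinuousLinearMap.fst ℝ ℝ ℝ))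
    (fun x => by ext <;> simp [hs, hr]) (fun x => by ext <;> simp [hs, hr])

/-- Completing the square: `u³ A(u) + w u² D(u) + w² C(u, w)` has an `A₂` singularity when
`A(0)` and `C(0, 0)` do not vanish. -/
theorem hasAkSingAt_two_of_decomposition {f : ℝ → ℝ → ℝ} {A D : ℝ → ℝ} {C : ℝ × ℝ → ℝ}
    (hA : ContDiff ℝ ∞ A) (hD : ContDiff ℝ ∞ D) (hC : ContDiff ℝ ∞ C)
    (hf : ∀ u w, f u w = u ^ 3 * A u + w * (u ^ 2 * D u) + w ^ 2 * C (u, w))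
    (hA0 : A 0 ≠ 0) (hC0 : C (0, 0) ≠ 0) : HasAkSingAt f 2 := by
  obtain ⟨σ, hσ, hσC⟩ := exists_sign_mul_pos hC0
  obtain ⟨τ, hτ, hτA⟩ := exists_sign_mul_pos hA0
  let Q : ℝ × ℝ → ℝ := fun x => A x.1 - x.1 * D x.1 ^ 2 / (4 * C x)
  let s : ℝ × ℝ → ℝ := fun x => √(σ * C x)
  let r : ℝ × ℝ → ℝ := fun x => (τ * Q x) ^ (1 / 3 : ℝ)
  let Ψ : ℝ × ℝ → ℝ × ℝ := fun x =>
    (x.2 * s x + x.1 ^ 2 * (s x * D x.1 / (2 * C x)), x.1 * r x)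
  have hQ : ∀ x, C x ≠ 0 → ContDiffAt ℝ ∞ Q x := fun x hx => by
    have h4 : 4 * C x ≠ 0 := mul_ne_zero four_ne_zero hx
    have := hC.contDiffAt (x := x)
    exact ContDiffAt.sub (by fun_prop) (ContDiffAt.div (by fun_prop) (by fun_prop) h4)
  have hQ0 : Q (0, 0) = A 0 := by simp [Q]
  have hev : ∀ᶠ x in 𝓝 ((0, 0) : ℝ × ℝ), 0 < σ * C x ∧ 0 < τ * Q x := by
    refine Filter.Eventually.and ?_ ?_
    · exact (continuous_const.mul hC.continuous).continuousAt.eventually (lt_mem_nhds hσC)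
    · exact (continuousAt_const.mul (hQ _ hC0).continuousAt).eventually
        (lt_mem_nhds (hQ0.symm ▸ hτA : 0 < τ * Q (0, 0)))
  obtain ⟨W, hWpos, hW, h0W⟩ := eventually_nhds_iff.1 hev
  have hCne : ∀ x ∈ W, C x ≠ 0 := fun x hx h => by
    have := (hWpos x hx).1
    simp [h] at this
  have hs : ∀ x ∈ W, ContDiffAt ℝ ∞ s x := fun x hx =>
    (contDiffAt_const.mul hC.contDiffAt).sqrt (hWpos x hx).1.ne'
  have hr : ∀ x ∈ W, ContDiffAt ℝ ∞ r x := fun x hx =>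
    (contDiffAt_const.mul (hQ x (hCne x hx))).rpow_const_of_ne (hWpos x hx).2.ne'
  have hm : ∀ x ∈ W, ContDiffAt ℝ ∞ (fun x => s x * D x.1 / (2 * C x)) x := fun x hx => by
    have h2 : 2 * C x ≠ 0 := mul_ne_zero two_ne_zero (hCne x hx)
    have := hs x hx
    exact ContDiffAt.div (by fun_prop) (by fun_prop) h2
  have hΨ : ContDiffOn ℝ ∞ Ψ W := fun x hx => by
    have h1 := hs x hx
    have h2 := hr x hx
    have h3 := hm x hx
    exact ContDiffAt.contDiffWithinAt (ContDiffAt.prodMk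
      ((contDiffAt_snd.mul h1).add ((contDiffAt_fst.pow 2).mul h3)) (contDiffAt_fst.mul h2))
  have hs0 : s (0, 0) ≠ 0 := (Real.sqrt_pos.2 (hWpos _ h0W).1).ne'
  have hr0 : r (0, 0) ≠ 0 := (Real.rpow_pos_of_pos (hWpos _ h0W).2 _).ne'
  have hΨ' : HasFDerivAt Ψ (swapScale _ _ hs0 hr0 : (ℝ × ℝ) →L[ℝ] (ℝ × ℝ)) (0, 0) := by
    have d1 := ((hs _ h0W).differentiableAt (by simp)).hasFDerivAt
    have d2 := ((hr _ h0W).differentiableAt (by simp)).hasFDerivAt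
    have d3 := ((hm _ h0W).differentiableAt (by simp)).hasFDerivAt
    have dx : HasFDerivAt (fun x : ℝ × ℝ => x.1) (ContinuousLinearMap.fst ℝ ℝ ℝ) (0, 0) :=
      hasFDerivAt_fst
    have dy : HasFDerivAt (fun x : ℝ × ℝ => x.2) (ContinuousLinearMap.snd ℝ ℝ ℝ) (0, 0) :=
      hasFDerivAt_snd
    refine (((dy.mul d1).add ((dx.pow 2).mul d3)).prodMk (dx.mul d2)).congr_fderiv ?_
    ext <;> simp [swapScale]
  obtain ⟨Φ, h0, hΦW, hΦ, hsymm⟩ :=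
    exists_openPartialHomeomorph_contDiffOn_symm hW h0W hΨ _ hΨ'
  have hΦ0 : Φ (0, 0) = (0, 0) := by rw [hΦ]; simp [Ψ]
  have h0t : ((0, 0) : ℝ × ℝ) ∈ Φ.target := hΦ0 ▸ Φ.map_source h0
  refine ⟨Φ.target, Φ.source, Φ.symm, Φ, σ, τ, Φ.open_target, Φ.open_source, h0t, h0, hsymm,
    hΦ ▸ hΨ.mono hΦW, Φ.mapsTo_symm, Φ.mapsTo, fun x hx => Φ.right_inv hx,
    fun y hy => Φ.left_inv hy, ?_, hσ, hτ, fun x hx => ?_⟩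
  · have h := Φ.left_inv h0
    rwa [hΦ0] at h
  · have hz := hΦW (Φ.map_target hx)
    have hxz : Ψ (Φ.symm x) = x := by rw [← hΦ]; exact Φ.right_inv hx
    set z := Φ.symm x
    have hsq : s z ^ 2 = σ * C z := Real.sq_sqrt (hWpos z hz).1.le
    have hcb : r z ^ 3 = τ * Q z := by
      rw [← Real.rpow_natCast, ← Real.rpow_mul (hWpos z hz).2.le]
      norm_num
    have hσ2 : σ ^ 2 = 1 := by rcases hσ with h | h <;> simp [h]
    have hτ2 : τ ^ 2 = 1 := by rcases hτ with h | h <;> simp [h]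
    have hCz := hCne z hz
    have h1 : x.1 = s z * (z.2 + z.1 ^ 2 * (D z.1 / (2 * C z))) := by
      rw [← hxz]; simp only [Ψ]; ring
    have h2 : x.2 = z.1 * r z := by rw [← hxz]
    rw [hf, hf, h1, h2, mul_pow, mul_pow, hsq, show 2 + 1 = 3 from rfl, hcb,
      show σ * (σ * C z * (z.2 + z.1 ^ 2 * (D z.1 / (2 * C z))) ^ 2)
        = σ ^ 2 * (C z * (z.2 + z.1 ^ 2 * (D z.1 / (2 * C z))) ^ 2) by ring,
      show τ * (z.1 ^ 3 * (τ * Q z)) = τ ^ 2 * (z.1 ^ 3 * Q z) by ring, hσ2, hτ2]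
    simp only [Q]
    field_simp
    ring

/-- If `u³ A(u) + w u² D(u) + w² C(u, w)` has an `A₂` singularity, then `A(0) ≠ 0`. -/
theorem ne_zero_of_hasAkSingAt_two {f : ℝ → ℝ → ℝ} {A D : ℝ → ℝ} {C : ℝ × ℝ → ℝ}
    (hA : ContinuousAt A 0) (hD : ContinuousAt D 0) (hC : ContinuousAt C (0, 0))
    (hf : ∀ u w, f u w = u ^ 3 * A u + w * (u ^ 2 * D u) + w ^ 2 * C (u, w))
    (hC0 : C (0, 0) ≠ 0) (h : HasAkSingAt f 2) : A 0 ≠ 0 := by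
  intro hA0
  obtain ⟨U, V, φ, -, ε₁, ε₂, hU, -, h0U, -, hφ, -, -, -, -, -, hφ0, -, hε₂, hfφ⟩ := h
  have hε : ε₂ ≠ 0 := by rcases hε₂ with h | h <;> simp [h]
  have hmem : ∀ᶠ t in 𝓝 (0 : ℝ), ((0, t) : ℝ × ℝ) ∈ U :=
    (by fun_prop : Continuous fun t : ℝ => ((0, t) : ℝ × ℝ)).continuousAt.eventually
      (hU.mem_nhds h0U)
  have hd : DifferentiableAt ℝ (fun t : ℝ => φ (0, t)) 0 :=
    ((hφ.contDiffAt (hU.mem_nhds h0U)).differentiableAt (by simp)).comp (0 : ℝ)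
      (by fun_prop : DifferentiableAt ℝ (fun t : ℝ => ((0, t) : ℝ × ℝ)) 0)
  set x : ℝ → ℝ := fun t => (φ (0, t)).1
  set y : ℝ → ℝ := fun t => (φ (0, t)).2
  have hx0 : x 0 = 0 := by simp [x, hφ0]
  have hy0 : y 0 = 0 := by simp [y, hφ0]
  have hxd : DifferentiableAt ℝ x 0 := hd.fst
  have hyd : DifferentiableAt ℝ y 0 := hd.snd
  have hX : Tendsto (fun t => x t / t) (𝓝[≠] 0) (𝓝 (deriv x 0)) := by
    have := hasDerivAt_iff_tendsto_slope.1 hxd.hasDerivAt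
    refine this.congr fun t => ?_
    simp [slope_def_field, hx0]
  have hY : Tendsto (fun t => y t / t) (𝓝[≠] 0) (𝓝 (deriv y 0)) := by
    have := hasDerivAt_iff_tendsto_slope.1 hyd.hasDerivAt
    refine this.congr fun t => ?_
    simp [slope_def_field, hy0]
  have hxc : Tendsto x (𝓝[≠] 0) (𝓝 0) := by
    simpa [hx0] using hxd.continuousAt.tendsto.mono_left nhdsWithin_le_nhds
  have hyc : Tendsto y (𝓝[≠] 0) (𝓝 0) := by
    simpa [hy0] using hyd.continuousAt.tendsto.mono_left nhdsWithin_le_nhds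
  have hAx : Tendsto (fun t => A (x t)) (𝓝[≠] 0) (𝓝 0) := by
    have := hA.tendsto.comp hxc
    rwa [hA0] at this
  have hDx : Tendsto (fun t => D (x t)) (𝓝[≠] 0) (𝓝 (D 0)) := hD.tendsto.comp hxc
  have hCx : Tendsto (fun t => C (x t, y t)) (𝓝[≠] 0) (𝓝 (C (0, 0))) :=
    hC.tendsto.comp (hxc.prodMk_nhds hyc)
  have ht : Tendsto (fun t : ℝ => t) (𝓝[≠] 0) (𝓝 0) := tendsto_id.mono_left nhdsWithin_le_nhds
  have heq : ∀ᶠ t in 𝓝[≠] (0 : ℝ),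
      ε₂ * t ^ 3 = x t ^ 3 * A (x t) + y t * (x t ^ 2 * D (x t)) + y t ^ 2 * C (x t, y t) := by
    filter_upwards [nhdsWithin_le_nhds hmem] with t ht
    have h1 := hfφ _ ht
    have h2 : f 0 0 = 0 := by simp [hf]
    rw [hf, h2] at h1
    simp only [x, y]
    rw [h1]
    simp
  have hY0 : deriv y 0 = 0 := by
    have hl : Tendsto (fun t => ε₂ * t - (x t * ((x t / t) ^ 2 * A (x t))
        + y t * ((x t / t) ^ 2 * D (x t)))) (𝓝[≠] 0)
        (𝓝 (ε₂ * 0 - (0 * (deriv x 0 ^ 2 * 0) + 0 * (deriv x 0 ^ 2 * D 0)))) :=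
      (ht.const_mul _).sub ((hxc.mul ((hX.pow 2).mul hAx)).add (hyc.mul ((hX.pow 2).mul hDx)))
    have hr : Tendsto (fun t => (y t / t) ^ 2 * C (x t, y t)) (𝓝[≠] 0)
        (𝓝 (deriv y 0 ^ 2 * C (0, 0))) := (hY.pow 2).mul hCx
    have := tendsto_nhds_unique (hl.congr' ?_) hr
    · have h0 : deriv y 0 ^ 2 * C (0, 0) = 0 := by rw [← this]; ring
      simpa [hC0] using h0
    · filter_upwards [heq, self_mem_nhdsWithin] with t h ht0
      have ht0 : t ≠ 0 := ht0
      field_simp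
      linear_combination h
  have hlim : Tendsto (fun t => y t ^ 2 / t ^ 3) (𝓝[≠] 0) (𝓝 (ε₂ / C (0, 0))) := by
    have hl : Tendsto (fun t => (ε₂ - ((x t / t) ^ 3 * A (x t)
        + (y t / t) * ((x t / t) ^ 2 * D (x t)))) / C (x t, y t)) (𝓝[≠] 0)
        (𝓝 ((ε₂ - (deriv x 0 ^ 3 * 0 + deriv y 0 * (deriv x 0 ^ 2 * D 0))) / C (0, 0))) :=
      (tendsto_const_nhds.sub (((hX.pow 3).mul hAx).add (hY.mul ((hX.pow 2).mul hDx)))).div hCx hC0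
    rw [hY0] at hl
    simp only [mul_zero, zero_mul, add_zero, sub_zero] at hl
    refine hl.congr' ?_
    filter_upwards [heq, self_mem_nhdsWithin, hCx.eventually_ne hC0] with t h ht0 hCt
    have ht0 : t ≠ 0 := ht0
    field_simp
    linear_combination h
  have hpos : 0 ≤ ε₂ / C (0, 0) := by
    refine ge_of_tendsto (hlim.mono_left (nhdsGT_le_nhdsNE 0)) ?_
    filter_upwards [self_mem_nhdsWithin] with t (ht : 0 < t)
    positivity
  have hneg : ε₂ / C (0, 0) ≤ 0 := by
    refine le_of_tendsto (hlim.mono_left (nhdsLT_le_nhdsNE 0)) ?_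
    filter_upwards [self_mem_nhdsWithin] with t (ht : t < 0)
    exact div_nonpos_of_nonneg_of_nonpos (sq_nonneg _) (Odd.pow_nonpos (by decide) ht.le)
  exact div_ne_zero hε hC0 (le_antisymm hneg hpos)

theorem pdu_eq_fderiv {f : ℝ → ℝ → ℝ} (hf : ContDiff ℝ ∞ fun x : ℝ × ℝ => f x.1 x.2) (u w : ℝ) :
    pdu f u w = fderiv ℝ (fun x : ℝ × ℝ => f x.1 x.2) (u, w) (1, 0) := by
  have h := ((hf.differentiable (by simp)).differentiableAt.hasFDerivAt
    (x := (u, w))).comp_hasDerivAt u ((hasDerivAt_id u).prodMk (hasDerivAt_const u w))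
  exact h.deriv

theorem pdw_eq_fderiv {f : ℝ → ℝ → ℝ} (hf : ContDiff ℝ ∞ fun x : ℝ × ℝ => f x.1 x.2) (u w : ℝ) :
    pdw f u w = fderiv ℝ (fun x : ℝ × ℝ => f x.1 x.2) (u, w) (0, 1) := by
  have h := ((hf.differentiable (by simp)).differentiableAt.hasFDerivAt
    (x := (u, w))).comp_hasDerivAt w ((hasDerivAt_const w u).prodMk (hasDerivAt_id w))
  exact h.deriv

theorem contDiff_pdu {f : ℝ → ℝ → ℝ} (hf : ContDiff ℝ ∞ fun x : ℝ × ℝ => f x.1 x.2) :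
    ContDiff ℝ ∞ fun x : ℝ × ℝ => pdu f x.1 x.2 := by
  simp only [pdu_eq_fderiv hf]
  exact (hf.fderiv_right (by simp)).clm_apply contDiff_const

theorem contDiff_pdw {f : ℝ → ℝ → ℝ} (hf : ContDiff ℝ ∞ fun x : ℝ × ℝ => f x.1 x.2) :
    ContDiff ℝ ∞ fun x : ℝ × ℝ => pdw f x.1 x.2 := by
  simp only [pdw_eq_fderiv hf]
  exact (hf.fderiv_right (by simp)).clm_apply contDiff_const

/-- Mixed partial derivatives of a smooth function commute. -/
theorem pdw_pdu_comm {f : ℝ → ℝ → ℝ} (hf : ContDiff ℝ ∞ fun x : ℝ × ℝ => f x.1 x.2) :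
    pdw (pdu f) = pdu (pdw f) := by
  funext u w
  have hd : DifferentiableAt ℝ (fderiv ℝ fun x : ℝ × ℝ => f x.1 x.2) (u, w) :=
    ((hf.fderiv_right (m := ∞) (by simp)).differentiable (by simp)) _
  rw [pdw_eq_fderiv (contDiff_pdu hf), pdu_eq_fderiv (contDiff_pdw hf)]
  simp only [pdu_eq_fderiv hf, pdw_eq_fderiv hf]
  have h1 := (hd.hasFDerivAt.clm_apply (hasFDerivAt_const ((1 : ℝ), (0 : ℝ)) (u, w))).fderiv
  have h2 := (hd.hasFDerivAt.clm_apply (hasFDerivAt_const ((0 : ℝ), (1 : ℝ)) (u, w))).fderiv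
  simp only [Prod.mk.eta]
  rw [h1, h2]
  simpa using (hf.contDiffAt.isSymmSndFDerivAt
    (by simp only [minSmoothness_of_isRCLikeNormedField]; exact ENat.LEInfty.out)) (0, 1) (1, 0)

/-- The chain rule along a plane curve. -/
theorem hasDerivAt_comp_curve {g : ℝ → ℝ → ℝ} (hg : ContDiff ℝ ∞ fun x : ℝ × ℝ => g x.1 x.2)
    {c : ℝ → ℝ × ℝ} {c' : ℝ × ℝ} {t : ℝ} (hc : HasDerivAt c c' t) :
    HasDerivAt (fun t => g (c t).1 (c t).2)
      (pdu g (c t).1 (c t).2 * c'.1 + pdw g (c t).1 (c t).2 * c'.2) t := by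
  have h := ((hg.differentiable (by simp)).differentiableAt.hasFDerivAt
    (x := c t)).comp_hasDerivAt t hc
  rw [pdu_eq_fderiv hg, pdw_eq_fderiv hg]
  refine h.congr_deriv ?_
  have hc' : c' = c'.1 • ((1 : ℝ), (0 : ℝ)) + c'.2 • ((0 : ℝ), (1 : ℝ)) := by ext <;> simp
  conv_lhs => rw [hc', map_add, map_smul, map_smul]
  simp only [smul_eq_mul]
  ring

/-- The tangent of a curve in the parabolic set is annihilated by `(a₃₀, a₂₁)`. -/
theorem MongeForm.tangent_parabolic {f : ℝ → ℝ → ℝ} {k₂ : ℝ} (hM : MongeForm f k₂)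
    {c : ℝ → ℝ × ℝ} {c' : ℝ × ℝ} (hc : HasDerivAt c c' 0) (hc0 : c 0 = (0, 0))
    (hP : ∀ᶠ t in 𝓝 (0 : ℝ), Pfun f (c t).1 (c t).2 = 0) :
    pd 3 0 f 0 0 * c'.1 + pd 2 1 f 0 0 * c'.2 = 0 := by
  obtain ⟨hf, -, -, -, fuu, fuw, fww, hk⟩ := hM
  have h20 := hasDerivAt_comp_curve (g := pd 2 0 f) (contDiff_pdu (contDiff_pdu hf)) hc
  have h02 := hasDerivAt_comp_curve (g := pd 0 2 f) (contDiff_pdw (contDiff_pdw hf)) hc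
  have h11 := hasDerivAt_comp_curve (g := pd 1 1 f) (contDiff_pdu (contDiff_pdw hf)) hc
  have h := ((h20.mul h02).sub (h11.pow 2)).unique
    ((hasDerivAt_const (0 : ℝ) (0 : ℝ)).congr_of_eventuallyEq hP)
  have hcomm : pdw (pd 2 0 f) = pd 2 1 f := by
    change pdw (pdu (pdu f)) = pdu (pdu (pdw f))
    rw [pdw_pdu_comm (contDiff_pdu hf), pdw_pdu_comm hf]
  have h30 : pdu (pd 2 0 f) = pd 3 0 f := rfl
  rw [hcomm, h30] at h
  simp only [hc0, fuu, fuw, fww] at h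
  refine (mul_eq_zero.1 (?_ : _ * k₂ = 0)).resolve_right hk
  simpa using h

theorem ContDiffAt.eventually_differentiableAt_of_two {g : ℝ → ℝ} {x : ℝ}
    (hg : ContDiffAt ℝ 2 g x) : ∀ᶠ t in 𝓝 x, DifferentiableAt ℝ g t :=
  (hg.eventually (by simp)).mono fun _ ht => ht.differentiableAt (by simp)

theorem ContDiffAt.differentiableAt_deriv_of_two {g : ℝ → ℝ} {x : ℝ}
    (hg : ContDiffAt ℝ 2 g x) : DifferentiableAt ℝ (deriv g) x := by
  have h : ContDiffAt ℝ 1 (fderiv ℝ g) x := hg.fderiv_right (by norm_num)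
  exact (h.differentiableAt (by simp)).clm_apply (differentiableAt_const (1 : ℝ))

/-- First and second derivative of `p² q` at a zero of `p`. -/
theorem deriv_sq_mul_of_eq_zero {p q : ℝ → ℝ} (hp : ContDiffAt ℝ 2 p 0) (hq : ContDiffAt ℝ 2 q 0)
    (h0 : p 0 = 0) : deriv (fun t => p t ^ 2 * q t) 0 = 0 ∧
      deriv (deriv fun t => p t ^ 2 * q t) 0 = 2 * deriv p 0 ^ 2 * q 0 := by
  have hd : ∀ t, DifferentiableAt ℝ p t → DifferentiableAt ℝ q t →
      deriv (fun t => p t ^ 2 * q t) t = 2 * p t * deriv p t * q t + p t ^ 2 * deriv q t :=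
    fun t h1 h2 => by
      refine ((h1.hasDerivAt.pow 2).mul h2.hasDerivAt).deriv.trans ?_
      simp
  refine ⟨by rw [hd 0 (hp.differentiableAt (by simp)) (hq.differentiableAt (by simp)), h0]; ring, ?_⟩
  have heq : deriv (fun t => p t ^ 2 * q t) =ᶠ[𝓝 0]
      fun t => 2 * p t * deriv p t * q t + p t ^ 2 * deriv q t := by
    filter_upwards [hp.eventually_differentiableAt_of_two,
      hq.eventually_differentiableAt_of_two] with t h1 h2 using hd t h1 h2
  have dp := (hp.differentiableAt (by simp)).hasDerivAt
  have dq := (hq.differentiableAt (by simp)).hasDerivAt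
  rw [heq.deriv_eq]
  refine ((((dp.const_mul 2).mul hp.differentiableAt_deriv_of_two.hasDerivAt).mul dq).add
    ((dp.pow 2).mul hq.differentiableAt_deriv_of_two.hasDerivAt)).deriv.trans ?_
  simp only [h0, Pi.mul_apply, Pi.pow_apply]
  ring

/-- The first two derivatives of a sum. -/
theorem deriv_deriv_add_of_contDiffAt {p q : ℝ → ℝ} (hp : ContDiffAt ℝ 2 p 0)
    (hq : ContDiffAt ℝ 2 q 0) : deriv (fun t => p t + q t) 0 = deriv p 0 + deriv q 0 ∧
      deriv (deriv fun t => p t + q t) 0 = deriv (deriv p) 0 + deriv (deriv q) 0 := by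
  refine ⟨deriv_fun_add (hp.differentiableAt (by simp)) (hq.differentiableAt (by simp)), ?_⟩
  have heq : deriv (fun t => p t + q t) =ᶠ[𝓝 0] fun t => deriv p t + deriv q t := by
    filter_upwards [hp.eventually_differentiableAt_of_two,
      hq.eventually_differentiableAt_of_two] with t h1 h2 using deriv_fun_add h1 h2
  rw [heq.deriv_eq]
  exact deriv_fun_add hp.differentiableAt_deriv_of_two hq.differentiableAt_deriv_of_two

/-- The first two derivatives of a space curve are computed componentwise. -/
theorem deriv_deriv_prodMk_of_contDiffAt {x y z : ℝ → ℝ} (hx : ContDiffAt ℝ 2 x 0)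
    (hy : ContDiffAt ℝ 2 y 0) (hz : ContDiffAt ℝ 2 z 0) :
    deriv (fun t => (x t, y t, z t)) 0 = (deriv x 0, deriv y 0, deriv z 0) ∧
      deriv (deriv fun t => (x t, y t, z t)) 0 =
        (deriv (deriv x) 0, deriv (deriv y) 0, deriv (deriv z) 0) := by
  have hd : ∀ {x y z : ℝ → ℝ} {t : ℝ}, DifferentiableAt ℝ x t → DifferentiableAt ℝ y t →
      DifferentiableAt ℝ z t → deriv (fun t => (x t, y t, z t)) t =
        (deriv x t, deriv y t, deriv z t) := fun hx hy hz =>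
    (hx.hasDerivAt.prodMk (hy.hasDerivAt.prodMk hz.hasDerivAt)).deriv
  refine ⟨hd (hx.differentiableAt (by simp)) (hy.differentiableAt (by simp))
    (hz.differentiableAt (by simp)), ?_⟩
  have heq : deriv (fun t => (x t, y t, z t)) =ᶠ[𝓝 0]
      fun t => (deriv x t, deriv y t, deriv z t) := by
    filter_upwards [hx.eventually_differentiableAt_of_two, hy.eventually_differentiableAt_of_two,
      hz.eventually_differentiableAt_of_two] with t h1 h2 h3 using hd h1 h2 h3
  rw [heq.deriv_eq]
  exact hd hx.differentiableAt_deriv_of_two hy.differentiableAt_deriv_of_two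
    hz.differentiableAt_deriv_of_two

/-- A vector of `ℝ³` scaled to unit length is `±(0,0,1)` iff it is vertical. -/
theorem normalize_eq_vertical_iff {v : ℝ × ℝ × ℝ} (hv : v ≠ 0) :
    ((norm3 v)⁻¹ • v = (((0 : ℝ), (0 : ℝ), (1 : ℝ)) : ℝ × ℝ × ℝ) ∨
      (norm3 v)⁻¹ • v = (((0 : ℝ), (0 : ℝ), (-1 : ℝ)) : ℝ × ℝ × ℝ)) ↔ v.1 = 0 ∧ v.2.1 = 0 := by
  obtain ⟨a, b, z⟩ := v
  have hn : norm3 (a, b, z) ≠ 0 := by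
    intro h
    have h' : √(a * a + b * b + z * z) = 0 := h
    have h2 := (Real.sqrt_eq_zero (by
      nlinarith [mul_self_nonneg a, mul_self_nonneg b, mul_self_nonneg z])).1 h'
    have ha : a = 0 := by nlinarith [mul_self_nonneg a, mul_self_nonneg b, mul_self_nonneg z]
    have hb : b = 0 := by nlinarith [mul_self_nonneg a, mul_self_nonneg b, mul_self_nonneg z]
    have hz : z = 0 := by nlinarith [mul_self_nonneg a, mul_self_nonneg b, mul_self_nonneg z]
    exact hv (by simp [ha, hb, hz])
  constructor
  · rintro (h | h) <;> simp only [Prod.smul_mk, smul_eq_mul, Prod.mk.injEq, mul_eq_zero,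
      inv_eq_zero, hn, false_or] at h <;> exact ⟨h.1, h.2.1⟩
  · rintro ⟨rfl, rfl⟩
    have hz : z ≠ 0 := by rintro rfl; exact hv rfl
    have hnz : norm3 ((0 : ℝ), (0 : ℝ), z) = |z| := by
      simp [norm3, dot3, Real.sqrt_mul_self_eq_abs]
    rw [hnz]
    rcases hz.lt_or_gt with h | h
    · right; simp [abs_of_neg h, hz, inv_neg]
    · left; simp [abs_of_pos h, hz]

/-- for a parabolic Monge form `f` with nonsingular parabolic set and a
parameterization `L` of the parabolic set on the graph surface with nonvanishing curvature,
`f` has an `A₂` singularity at the origin iff the unit binormal `b(0)` is not `±(0,0,1)`. -/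
theorem monge_A2_iff_binormal (f : ℝ → ℝ → ℝ) (k₂ : ℝ) (hM : MongeForm f k₂)
    (hpar : ¬(pd 3 0 f 0 0 = 0 ∧ pd 2 1 f 0 0 = 0))
    (ε : ℝ) (hε : 0 < ε) (c : ℝ → ℝ × ℝ) (hc : ContDiffOn ℝ (⊤ : ℕ∞) c (Set.Ioo (-ε) ε))
    (hc0 : c 0 = (0, 0)) (hc' : deriv c 0 ≠ (0, 0))
    (hP : ∀ t : ℝ, |t| < ε → Pfun f (c t).1 (c t).2 = 0) :
    let L : ℝ → ℝ × ℝ × ℝ := fun t => ((c t).1, (c t).2, f (c t).1 (c t).2)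
    cross3 (deriv L 0) (deriv (deriv L) 0) ≠ 0 →
      (HasAkSingAt f 2 ↔
        ¬(binormal0 L = (((0 : ℝ), (0 : ℝ), (1 : ℝ)) : ℝ × ℝ × ℝ) ∨
          binormal0 L = (((0 : ℝ), (0 : ℝ), (-1 : ℝ)) : ℝ × ℝ × ℝ))) := by
  intro L hL
  obtain ⟨A, D, C, hA, hD, hC, hf, hA0, hC0⟩ := hM.exists_decomposition
  have hk : k₂ ≠ 0 := hM.2.2.2.2.2.2.2
  have hC00 : C (0, 0) ≠ 0 := by
    intro h
    simp [h] at hC0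
    exact hk hC0
  have hnhds : Set.Ioo (-ε) ε ∈ 𝓝 (0 : ℝ) := Ioo_mem_nhds (by linarith) hε
  have hcs : ContDiffAt ℝ ∞ c 0 := hc.contDiffAt hnhds
  have htan := hM.tangent_parabolic (hcs.differentiableAt (by simp)).hasDerivAt hc0
    (Filter.mem_of_superset hnhds fun t ht => hP t (abs_lt.2 ht))
  have hA2 : HasAkSingAt f 2 ↔ A 0 ≠ 0 :=
    ⟨ne_zero_of_hasAkSingAt_two hA.continuous.continuousAt hD.continuous.continuousAt
      hC.continuous.continuousAt hf hC00,
      fun h => hasAkSingAt_two_of_decomposition hA hD hC hf h hC00⟩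
  let p : ℝ → ℝ := fun t => (c t).1
  let q : ℝ → ℝ := fun t => (c t).2
  have two_le : (2 : WithTop ℕ∞) ≤ ∞ := ENat.LEInfty.out
  have hp : ContDiffAt ℝ 2 p 0 := (hcs.of_le two_le).fst
  have hq : ContDiffAt ℝ 2 q 0 := (hcs.of_le two_le).snd
  have hp0 : p 0 = 0 := by simp [p, hc0]
  have hq0 : q 0 = 0 := by simp [q, hc0]
  let G : ℝ → ℝ := fun t => p t * A (p t) + q t * D (p t)
  let H : ℝ → ℝ := fun t => C (p t, q t)
  have hG : ContDiffAt ℝ 2 G 0 :=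
    (hp.mul ((hA.of_le two_le).contDiffAt.comp 0 hp)).add
      (hq.mul ((hD.of_le two_le).contDiffAt.comp 0 hp))
  have hH : ContDiffAt ℝ 2 H 0 := (hC.of_le two_le).contDiffAt.comp 0 (hp.prodMk hq)
  have hLeq : L = fun t => (p t, q t, p t ^ 2 * G t + q t ^ 2 * H t) := by
    funext t
    simp only [L, p, q, G, H, hf]
    congr 2
    ring
  have hpG := (hp.pow 2).mul hG
  have hqH := (hq.pow 2).mul hH
  have hL1 := deriv_deriv_prodMk_of_contDiffAt hp hq (hpG.add hqH)
  have hz := deriv_deriv_add_of_contDiffAt hpG hqH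
  have hz1 := deriv_sq_mul_of_eq_zero hp hG hp0
  have hz2 := deriv_sq_mul_of_eq_zero hq hH hq0
  have hL1' : deriv L 0 = (deriv p 0, deriv q 0, 0) := by
    rw [hLeq]
    refine hL1.1.trans ?_
    rw [Prod.mk.injEq, Prod.mk.injEq]
    exact ⟨rfl, rfl, hz.1.trans (by rw [hz1.1, hz2.1, add_zero])⟩
  have hL2' : deriv (deriv L) 0 =
      (deriv (deriv p) 0, deriv (deriv q) 0, 2 * deriv q 0 ^ 2 * C (0, 0)) := by
    rw [hLeq]
    refine hL1.2.trans ?_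
    rw [Prod.mk.injEq, Prod.mk.injEq]
    refine ⟨rfl, rfl, hz.2.trans ?_⟩
    rw [hz1.2, hz2.2]
    simp [G, H, hp0, hq0]
  have hcd : deriv c 0 = (deriv p 0, deriv q 0) :=
    ((hp.differentiableAt (by simp)).hasDerivAt.prodMk
      (hq.differentiableAt (by simp)).hasDerivAt).deriv
  rw [hcd] at htan hc'
  have hβ : A 0 = 0 ↔ deriv q 0 = 0 := by
    constructor
    · intro h
      rw [hA0, h] at htan hpar
      simp only [mul_zero, zero_mul, zero_add, true_and, mul_eq_zero] at htan hpar
      exact htan.resolve_left hpar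
    · intro h
      have hα : deriv p 0 ≠ 0 := fun h' => hc' (by rw [h, h'])
      rw [hA0, h] at htan
      simpa [hα] using htan
  rw [hA2, binormal0, normalize_eq_vertical_iff hL, hL1', hL2', not_iff_not, hβ]
  simp only [cross3]
  constructor
  · intro h
    simp [h]
  · rintro ⟨h, -⟩
    simpa [hC00] using h
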